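/- Let f, g : (0,∞) → [0,∞) be non-increasing functions with ∫_0^t log_+ f(s) ds < ∞ and ∫_0^t log_+ g(s) ds < ∞ for all t > 0. Then the following are equivalent: (i) ∫_0^t log f(s) ds ≤ ∫_0^t log g(s) ds for all t > 0; (ii) ∫_0^∞ log_+(r f(s)) ds ≤ ∫_0^∞ log_+(r g(s)) ds for all r > 0; (iii) ∫_0^t φ(f(s)) ds ≤ ∫_0^t φ(g(s)) ds for all t > 0 and all continuous increasing functions φ : [0,∞) → [0,∞) with φ(0) = 0 such that the composition φ ∘ exp is convex on ℝ. -/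

import Mathlib

open scoped ENNReal
open MeasureTheory

noncomputable section

/-- `∫₀ᵗ log f(s) ds` for a nonnegative function on `(0,∞)`, as an extended real number
(finite or `-∞` when the positive part `∫₀ᵗ log₊ f(s) ds` is finite). -/
def logIntF (f : ℝ → ℝ) (t : ℝ) : EReal :=
  ((∫⁻ s in Set.Ioc (0:ℝ) t, ENNReal.ofReal (Real.log (f s)) : ℝ≥0∞) : EReal)
    - ((∫⁻ s in Set.Ioc (0:ℝ) t,
        (if f s = 0 then ⊤ else ENNReal.ofReal (-Real.log (f s))) : ℝ≥0∞) : EReal)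

section LogMajorization

open Set Filter Topology

lemma ofReal_log_add_le {x r : ℝ} (hx : 0 ≤ x) (hr : 0 < r) :
    ENNReal.ofReal (Real.log x) + ENNReal.ofReal (Real.log r) ≤
      ENNReal.ofReal (Real.log (r * x)) +
        (if x = 0 then ⊤ else ENNReal.ofReal (-Real.log x)) + ENNReal.ofReal (-Real.log r) := by
  rcases hx.eq_or_lt with rfl | hx
  · simp
  rw [if_neg hx.ne', Real.log_mul hr.ne' hx.ne']
  rcases le_total 0 (Real.log x) with h | h <;> rcases le_total 0 (Real.log r) with h' | h'
  · rw [ENNReal.ofReal_of_nonpos (neg_nonpos.2 h), ENNReal.ofReal_of_nonpos (neg_nonpos.2 h'),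
      ← ENNReal.ofReal_add h h']
    simp [add_comm]
  · rw [ENNReal.ofReal_of_nonpos (neg_nonpos.2 h), ENNReal.ofReal_of_nonpos h', add_zero, add_zero]
    exact (ENNReal.ofReal_le_ofReal (by linarith)).trans ENNReal.ofReal_add_le
  · rw [ENNReal.ofReal_of_nonpos (neg_nonpos.2 h'), ENNReal.ofReal_of_nonpos h, zero_add, add_zero]
    exact (ENNReal.ofReal_le_ofReal (by linarith)).trans ENNReal.ofReal_add_le
  · simp [ENNReal.ofReal_of_nonpos h, ENNReal.ofReal_of_nonpos h']

lemma ofReal_log_mul_add {x r : ℝ} (hx : 0 ≤ x) (hr : 0 < r) (h1 : 1 ≤ r * x) :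
    ENNReal.ofReal (Real.log (r * x)) +
        (if x = 0 then ⊤ else ENNReal.ofReal (-Real.log x)) + ENNReal.ofReal (-Real.log r) =
      ENNReal.ofReal (Real.log x) + ENNReal.ofReal (Real.log r) := by
  rcases hx.eq_or_lt with rfl | hx
  · norm_num at h1
  have h0 := Real.log_nonneg h1
  rw [if_neg hx.ne']
  rw [Real.log_mul hr.ne' hx.ne'] at h0 ⊢
  rcases le_total 0 (Real.log x) with h | h <;> rcases le_total 0 (Real.log r) with h' | h'
  · rw [ENNReal.ofReal_of_nonpos (neg_nonpos.2 h), ENNReal.ofReal_of_nonpos (neg_nonpos.2 h'),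
      ← ENNReal.ofReal_add h h']
    simp [add_comm]
  · rw [ENNReal.ofReal_of_nonpos (neg_nonpos.2 h), ENNReal.ofReal_of_nonpos h', add_zero, add_zero,
      ← ENNReal.ofReal_add h0 (by linarith)]
    congr 1; ring
  · rw [ENNReal.ofReal_of_nonpos (neg_nonpos.2 h'), ENNReal.ofReal_of_nonpos h, zero_add, add_zero,
      ← ENNReal.ofReal_add h0 (by linarith)]
    congr 1; ring
  · have hxr : Real.log x = 0 ∧ Real.log r = 0 := ⟨by linarith, by linarith⟩
    simp [hxr]

lemma ofReal_log_mul_add_min {x r : ℝ} (hx : 0 ≤ x) (hr : 1 ≤ r) :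
    ENNReal.ofReal (Real.log (r * x)) +
        min (if x = 0 then ⊤ else ENNReal.ofReal (-Real.log x)) (ENNReal.ofReal (Real.log r)) =
      ENNReal.ofReal (Real.log x) + ENNReal.ofReal (Real.log r) := by
  rcases hx.eq_or_lt with rfl | hx
  · simp
  have hr0 : 0 < r := by linarith
  have h' := Real.log_nonneg hr
  rw [if_neg hx.ne', Real.log_mul hr0.ne' hx.ne']
  rcases le_total 0 (Real.log x) with h | h
  · rw [ENNReal.ofReal_of_nonpos (neg_nonpos.2 h), ENNReal.ofReal_add h' h, min_eq_left zero_le,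
      add_zero, add_comm]
  rw [ENNReal.ofReal_of_nonpos h, zero_add]
  rcases le_total 0 (Real.log r + Real.log x) with h2 | h2
  · rw [min_eq_left (ENNReal.ofReal_le_ofReal (by linarith)),
      ← ENNReal.ofReal_add h2 (by linarith)]
    congr 1; ring
  · rw [min_eq_right (ENNReal.ofReal_le_ofReal (by linarith)), ENNReal.ofReal_of_nonpos h2,
      zero_add]

lemma EReal.coe_sub_le_coe_sub_iff {a b c d : ℝ≥0∞} (ha : a ≠ ⊤) (hc : c ≠ ⊤) :
    (a : EReal) - b ≤ c - d ↔ a + d ≤ c + b := by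
  lift a to NNReal using ha
  lift c to NNReal using hc
  induction b with
  | top => simp
  | coe b =>
    induction d with
    | top =>
      simp only [EReal.coe_ennreal_top, EReal.sub_top, le_bot_iff, add_top, top_le_iff]
      refine iff_of_false ?_ (by simp)
      exact_mod_cast EReal.coe_ne_bot ((a : ℝ) - b)
    | coe d =>
      have : ((a : ℝ) - b ≤ c - d) ↔ a + d ≤ c + b := by
        rw [sub_le_sub_iff]; exact_mod_cast Iff.rfl
      simp only [EReal.coe_nnreal_eq_coe_real]
      exact_mod_cast this

lemma measurable_negPart_log :
    Measurable fun x : ℝ => if x = 0 then (⊤ : ℝ≥0∞) else ENNReal.ofReal (-Real.log x) :=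
  Measurable.ite (measurableSet_singleton 0) measurable_const
    Real.measurable_log.neg.ennreal_ofReal

lemma measure_isUpperSet_le {ν₁ ν₂ : Measure ℝ} (hν₁ : ν₁ ≪ volume)
    (h : ∀ c, 0 < c → ν₁ (Ioi c) ≤ ν₂ (Ioi c)) {U : Set ℝ} (hU0 : U ⊆ Ioi 0)
    (hU : IsUpperSet U) : ν₁ U ≤ ν₂ U := by
  rcases U.eq_empty_or_nonempty with rfl | hne
  · simp
  have hb : BddBelow U := ⟨0, fun x hx => (hU0 hx).le⟩
  have hc0 : 0 ≤ sInf U := le_csInf hne fun x hx => (hU0 hx).le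
  have hsub : Ioi (sInf U) ⊆ U := fun x hx => by
    obtain ⟨u, hu, hux⟩ := exists_lt_of_csInf_lt hne hx
    exact hU hux.le hu
  rcases hc0.eq_or_lt with hc | hc
  · have hUeq : U = Ioi 0 := hU0.antisymm (hc ▸ hsub)
    have hun : (Ioi 0 : Set ℝ) = ⋃ n : ℕ, Ioi (1 / ((n : ℝ) + 1)) := by
      ext x
      simp only [mem_Ioi, mem_iUnion]
      exact ⟨exists_nat_one_div_lt, fun ⟨n, hn⟩ => Nat.one_div_pos_of_nat.trans hn⟩
    have hmono : Monotone fun n : ℕ => Ioi (1 / ((n : ℝ) + 1)) := fun m n hmn =>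
      Ioi_subset_Ioi (Nat.one_div_le_one_div hmn)
    rw [hUeq, hun, hmono.measure_iUnion, hmono.measure_iUnion]
    exact iSup_mono fun n => h _ Nat.one_div_pos_of_nat
  · calc ν₁ U ≤ ν₁ (Ici (sInf U)) := measure_mono fun x hx => csInf_le hb hx
      _ = ν₁ (Ioi (sInf U)) := (measure_congr (hν₁.ae_eq Ioi_ae_eq_Ici)).symm
      _ ≤ ν₂ (Ioi (sInf U)) := h _ hc
      _ ≤ ν₂ U := measure_mono hsub

lemma integral_indicator_inv {c x : ℝ} (hc : 0 < c) (hx : 0 ≤ x) :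
    ENNReal.ofReal (∫ τ in (0:ℝ)..x, (Ioi c).indicator (fun τ => τ⁻¹) τ) =
      ENNReal.ofReal (Real.log (c⁻¹ * x)) := by
  rcases le_total x c with h | h
  · rw [ENNReal.ofReal_of_nonpos (Real.log_nonpos (by positivity)
      (by rw [inv_mul_le_iff₀ hc]; linarith))]
    rw [intervalIntegral.integral_of_le hx, setIntegral_eq_zero_of_forall_eq_zero]
    · simp
    · intro τ hτ
      exact indicator_of_notMem (by simpa using hτ.2.trans h) _
  · rw [intervalIntegral.integral_of_le hx, setIntegral_indicator measurableSet_Ioi,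
      show Ioc 0 x ∩ Ioi c = Ioc c x from ?_, ← intervalIntegral.integral_of_le h,
      integral_inv_of_pos hc (by linarith), div_eq_inv_mul]
    ext y
    simp only [mem_inter_iff, mem_Ioc, mem_Ioi]
    exact ⟨fun h => ⟨h.2, h.1.2⟩, fun h => ⟨⟨hc.trans h.1, h.2⟩, h.1⟩⟩

/-- The measure on `(0,∞)` whose density is the distribution function of `F` over `τ`. -/
def logDistrib {α : Type*} [MeasurableSpace α] (μ : Measure α) (F : α → ℝ) : Measure ℝ :=
  (volume.restrict (Ioi 0)).withDensity fun τ => μ {a | τ < F a} * ENNReal.ofReal τ⁻¹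

section LayerCake

variable {α : Type*} [MeasurableSpace α] {μ : Measure α} {F G : α → ℝ}

lemma measurable_logDistrib_density :
    Measurable fun τ : ℝ => μ {a | τ < F a} * ENNReal.ofReal τ⁻¹ := by
  refine Measurable.mul (Antitone.measurable fun s t hst => ?_) measurable_inv.ennreal_ofReal
  exact measure_mono fun a (ha : t < F a) => hst.trans_lt ha

lemma logDistrib_Ioi (hF0 : 0 ≤ᵐ[μ] F) (hF : AEMeasurable F μ) {c : ℝ} (hc : 0 < c) :
    logDistrib μ F (Ioi c) = ∫⁻ a, ENNReal.ofReal (Real.log (c⁻¹ * F a)) ∂μ := by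
  have key := lintegral_comp_eq_lintegral_meas_lt_mul (f := F)
    (g := (Ioi c).indicator fun τ : ℝ => τ⁻¹) μ hF0 hF ?_ ?_
  · rw [← lintegral_congr_ae (hF0.mono fun a ha => integral_indicator_inv hc ha), key, logDistrib,
      withDensity_apply _ measurableSet_Ioi, Measure.restrict_restrict measurableSet_Ioi,
      inter_eq_left.2 (Ioi_subset_Ioi hc.le), ← lintegral_indicator measurableSet_Ioi,
      ← lintegral_indicator measurableSet_Ioi]
    refine lintegral_congr fun τ => ?_
    by_cases h : c < τ
    · simp [indicator, h, hc.trans h]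
    · simp [indicator, h]
  · intro t ht
    rw [intervalIntegrable_iff_integrableOn_Ioc_of_le ht.le,
      integrableOn_indicator_iff measurableSet_Ioi]
    have hcont : ContinuousOn (fun τ : ℝ => τ⁻¹) (Icc c t) :=
      continuousOn_inv₀.mono fun x hx => (hc.trans_le hx.1).ne'
    exact (hcont.integrableOn_Icc).mono_set fun x hx => ⟨hx.1.le, hx.2.2⟩
  · filter_upwards [ae_restrict_mem measurableSet_Ioi] with τ hτ
    exact indicator_nonneg (fun x hx => inv_nonneg.2 (hc.trans hx).le) _

lemma lintegral_comp_eq_logDistrib (hF0 : 0 ≤ᵐ[μ] F) (hF : AEMeasurable F μ) {φ ψ : ℝ → ℝ}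
    (hφ : ContinuousOn φ (Ici 0)) (hφ0 : φ 0 = 0) (hψ : Measurable ψ) (hψ0 : ∀ τ, 0 ≤ ψ τ)
    (hderiv : ∀ τ, 0 < τ → HasDerivWithinAt φ (ψ τ * τ⁻¹) (Ioi τ) τ) :
    ∫⁻ a, ENNReal.ofReal (φ (F a)) ∂μ = ∫⁻ τ, ENNReal.ofReal (ψ τ) ∂logDistrib μ F := by
  have hint : ∀ t : ℝ, 0 ≤ t → IntervalIntegrable (fun τ => ψ τ * τ⁻¹) volume 0 t := by
    intro t ht
    rw [intervalIntegrable_iff_integrableOn_Ioc_of_le ht]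
    exact intervalIntegral.integrableOn_deriv_right_of_nonneg (hφ.mono Icc_subset_Ici_self)
      (fun x hx => hderiv x hx.1) (fun x hx => mul_nonneg (hψ0 x) (inv_nonneg.2 hx.1.le))
  have hFTC : ∀ x : ℝ, 0 ≤ x → ∫ τ in (0:ℝ)..x, ψ τ * τ⁻¹ = φ x := fun x hx => by
    rw [intervalIntegral.integral_eq_sub_of_hasDeriv_right_of_le hx
      (hφ.mono Icc_subset_Ici_self) (fun y hy => hderiv y hy.1) (hint x hx), hφ0, sub_zero]
  have key := lintegral_comp_eq_lintegral_meas_lt_mul (f := F) (g := fun τ => ψ τ * τ⁻¹) μ hF0 hF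
    (fun t ht => hint t ht.le) ((ae_restrict_mem measurableSet_Ioi).mono fun τ hτ =>
      mul_nonneg (hψ0 τ) (inv_nonneg.2 (le_of_lt hτ)))
  rw [← lintegral_congr_ae (hF0.mono fun a ha => congrArg ENNReal.ofReal (hFTC _ ha)), key,
    logDistrib, lintegral_withDensity_eq_lintegral_mul _ measurable_logDistrib_density
      hψ.ennreal_ofReal]
  refine lintegral_congr fun τ => ?_
  rw [ENNReal.ofReal_mul (hψ0 τ), Pi.mul_apply, mul_assoc, mul_comm (ENNReal.ofReal τ⁻¹)]

lemma lintegral_comp_le_of_convexOn_comp_exp (hF0 : 0 ≤ᵐ[μ] F) (hF : AEMeasurable F μ)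
    (hG0 : 0 ≤ᵐ[μ] G) (hG : AEMeasurable G μ)
    (h : ∀ r : ℝ, 0 < r → ∫⁻ a, ENNReal.ofReal (Real.log (r * F a)) ∂μ ≤
      ∫⁻ a, ENNReal.ofReal (Real.log (r * G a)) ∂μ)
    {φ : ℝ → ℝ} (hφ : ContinuousOn φ (Ici 0)) (hmono : MonotoneOn φ (Ici 0)) (hφ0 : φ 0 = 0)
    (hconv : ConvexOn ℝ univ fun u => φ (Real.exp u)) :
    ∫⁻ a, ENNReal.ofReal (φ (F a)) ∂μ ≤ ∫⁻ a, ENNReal.ofReal (φ (G a)) ∂μ := by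
  set H : ℝ → ℝ := fun u => derivWithin (fun u => φ (Real.exp u)) (Ioi u) u
  have hHmono : Monotone H := by
    simpa [monotoneOn_univ] using hconv.monotoneOn_rightDeriv
  have hH0 : ∀ u, 0 ≤ H u := fun u => MonotoneOn.derivWithin_nonneg
    fun x _ y _ hxy => hmono (Real.exp_pos x).le (Real.exp_pos y).le (Real.exp_le_exp.2 hxy)
  have hψ : Measurable fun τ => H (Real.log τ) := hHmono.measurable.comp Real.measurable_log
  have hderiv : ∀ τ, 0 < τ → HasDerivWithinAt φ (H (Real.log τ) * τ⁻¹) (Ioi τ) τ := by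
    intro τ hτ
    have h1 : HasDerivWithinAt (fun u => φ (Real.exp u)) (H (Real.log τ)) (Ioi (Real.log τ))
        (Real.log τ) := hconv.hasDerivWithinAt_rightDeriv_of_mem_interior (by simp)
    have h2 := h1.comp τ (Real.hasDerivAt_log hτ.ne').hasDerivWithinAt
      (fun x (hx : τ < x) => Real.log_lt_log hτ hx)
    refine h2.congr (fun x (hx : τ < x) => ?_) ?_
    · simp [Real.exp_log (hτ.trans hx)]
    · simp [Real.exp_log hτ]
  rw [lintegral_comp_eq_logDistrib hF0 hF hφ hφ0 hψ (fun τ => hH0 _) hderiv,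
    lintegral_comp_eq_logDistrib hG0 hG hφ hφ0 hψ (fun τ => hH0 _) hderiv,
    lintegral_eq_lintegral_meas_lt _ (ae_of_all _ fun τ => hH0 _) hψ.aemeasurable,
    lintegral_eq_lintegral_meas_lt _ (ae_of_all _ fun τ => hH0 _) hψ.aemeasurable]
  refine lintegral_mono fun y => ?_
  have hac : ∀ F : α → ℝ, logDistrib μ F ≪ volume.restrict (Ioi 0) := fun F =>
    withDensity_absolutelyContinuous _ _
  have hpos : ∀ F : α → ℝ, logDistrib μ F {τ | y < H (Real.log τ)} =
      logDistrib μ F ({τ | y < H (Real.log τ)} ∩ Ioi 0) := fun F => by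
    refine measure_congr ((hac F).ae_eq ?_)
    filter_upwards [ae_restrict_mem measurableSet_Ioi] with τ hτ
    exact propext (and_iff_left hτ).symm
  rw [hpos F, hpos G]
  refine measure_isUpperSet_le ((hac F).trans Measure.restrict_le_self.absolutelyContinuous) ?_
    inter_subset_right ?_
  · intro c hc
    rw [logDistrib_Ioi hF0 hF hc, logDistrib_Ioi hG0 hG hc]
    exact h _ (inv_pos.2 hc)
  · rintro a b hab ⟨ha, ha0 : 0 < a⟩
    exact ⟨lt_of_lt_of_le ha (hHmono (Real.log_le_log ha0 hab)), ha0.trans_le hab⟩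

end LayerCake

lemma convexOn_log_max_one_mul_exp {r : ℝ} (hr : 0 < r) :
    ConvexOn ℝ univ fun u => Real.log (max 1 (r * Real.exp u)) := by
  have : (fun u => Real.log (max 1 (r * Real.exp u))) =
      (fun _ : ℝ => (0:ℝ)) ⊔ fun u => u + Real.log r := by
    funext u
    rw [Pi.sup_apply, ← Real.exp_log hr, ← Real.exp_add, Real.log_exp,
      ← Real.exp_zero, ← Real.exp_monotone.map_max, Real.log_exp, add_comm]
  rw [this]
  exact (convexOn_const 0 convex_univ).sup ((convexOn_id convex_univ).add_const _)

lemma ofReal_log_max_one (x : ℝ) (hx : 0 ≤ x) :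
    ENNReal.ofReal (Real.log (max 1 x)) = ENNReal.ofReal (Real.log x) := by
  rcases le_total x 1 with h | h
  · rw [max_eq_left h, ENNReal.ofReal_of_nonpos (Real.log_nonpos hx h)]; simp
  · rw [max_eq_right h]

lemma lintegral_Ioi_eq_iSup_lintegral_Ioc (F : ℝ → ℝ≥0∞) :
    ∫⁻ s in Ioi (0:ℝ), F s = ⨆ n : ℕ, ∫⁻ s in Ioc (0:ℝ) (n + 1), F s := by
  rw [← setLIntegral_iUnion_of_directed]
  · congr 2
    ext x
    simp only [mem_Ioi, mem_iUnion, mem_Ioc]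
    refine ⟨fun hx => ?_, fun ⟨n, hn⟩ => hn.1⟩
    obtain ⟨n, hn⟩ := exists_nat_ge x
    exact ⟨n, hx, hn.trans (by simp)⟩
  · refine Monotone.directed_le fun m n hmn => Ioc_subset_Ioc_right ?_
    gcongr

section Antitone

variable {f g : ℝ → ℝ}

lemma AntitoneOn.aemeasurable_Ioc (hf : AntitoneOn f (Ioi 0)) (t : ℝ) :
    AEMeasurable f (volume.restrict (Ioc 0 t)) :=
  aemeasurable_restrict_of_antitoneOn measurableSet_Ioc (hf.mono Ioc_subset_Ioi_self)

lemma AntitoneOn.aemeasurable_negPart_log (hf : AntitoneOn f (Ioi 0)) (t : ℝ) :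
    AEMeasurable (fun s => if f s = 0 then (⊤ : ℝ≥0∞) else ENNReal.ofReal (-Real.log (f s)))
      (volume.restrict (Ioc 0 t)) :=
  measurable_negPart_log.comp_aemeasurable (hf.aemeasurable_Ioc t)

lemma lintegral_log_add_le (hf0 : ∀ s : ℝ, 0 < s → 0 ≤ f s) (hf : AntitoneOn f (Ioi 0))
    {r : ℝ} (hr : 0 < r) (t : ℝ) :
    (∫⁻ s in Ioc 0 t, ENNReal.ofReal (Real.log (f s))) +
        (∫⁻ _ in Ioc 0 t, ENNReal.ofReal (Real.log r)) ≤
      (∫⁻ s in Ioc 0 t, ENNReal.ofReal (Real.log (r * f s))) +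
        (∫⁻ s in Ioc 0 t, if f s = 0 then ⊤ else ENNReal.ofReal (-Real.log (f s))) +
        ∫⁻ _ in Ioc 0 t, ENNReal.ofReal (-Real.log r) := by
  have hN := hf.aemeasurable_negPart_log t
  rw [← lintegral_add_right _ measurable_const, ← lintegral_add_right' _ hN,
    ← lintegral_add_right _ measurable_const]
  exact setLIntegral_mono_ae' measurableSet_Ioc
    (ae_of_all _ fun s hs => ofReal_log_add_le (hf0 s hs.1) hr)

lemma lintegral_log_mul_add (hf0 : ∀ s : ℝ, 0 < s → 0 ≤ f s) (hf : AntitoneOn f (Ioi 0))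
    {r : ℝ} (hr : 0 < r) {t : ℝ} (h1 : ∀ s ∈ Ioo 0 t, 1 ≤ r * f s) :
    (∫⁻ s in Ioc 0 t, ENNReal.ofReal (Real.log (r * f s))) +
        (∫⁻ s in Ioc 0 t, if f s = 0 then ⊤ else ENNReal.ofReal (-Real.log (f s))) +
        (∫⁻ _ in Ioc 0 t, ENNReal.ofReal (-Real.log r)) =
      (∫⁻ s in Ioc 0 t, ENNReal.ofReal (Real.log (f s))) +
        ∫⁻ _ in Ioc 0 t, ENNReal.ofReal (Real.log r) := by
  have hN := hf.aemeasurable_negPart_log t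
  rw [← lintegral_add_right' _ hN, ← lintegral_add_right _ measurable_const,
    ← lintegral_add_right _ measurable_const]
  rw [← Measure.restrict_congr_set (Ioo_ae_eq_Ioc (μ := volume))]
  exact setLIntegral_congr_fun measurableSet_Ioo
    fun s hs => ofReal_log_mul_add (hf0 s hs.1) hr (h1 s hs)

lemma lintegral_log_mul_add_min (hf0 : ∀ s : ℝ, 0 < s → 0 ≤ f s) (hf : AntitoneOn f (Ioi 0))
    {r : ℝ} (hr : 1 ≤ r) (t : ℝ) :
    (∫⁻ s in Ioc 0 t, ENNReal.ofReal (Real.log (r * f s))) +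
        (∫⁻ s in Ioc 0 t, min (if f s = 0 then ⊤ else ENNReal.ofReal (-Real.log (f s)))
          (ENNReal.ofReal (Real.log r))) =
      (∫⁻ s in Ioc 0 t, ENNReal.ofReal (Real.log (f s))) +
        ∫⁻ _ in Ioc 0 t, ENNReal.ofReal (Real.log r) := by
  have hN := hf.aemeasurable_negPart_log t
  rw [← lintegral_add_right' _ (hN.min aemeasurable_const),
    ← lintegral_add_right _ measurable_const]
  exact setLIntegral_congr_fun measurableSet_Ioc
    fun s hs => ofReal_log_mul_add_min (hf0 s hs.1) hr

lemma setLIntegral_const_ne_top (t c : ℝ) : (∫⁻ _ in Ioc 0 t, ENNReal.ofReal c) ≠ ⊤ := by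
  simp [ENNReal.mul_eq_top]

lemma lintegral_log_mul_le_of_logIntF_le (hf0 : ∀ s : ℝ, 0 < s → 0 ≤ f s)
    (hg0 : ∀ s : ℝ, 0 < s → 0 ≤ g s)
    (hfd : AntitoneOn f (Ioi 0)) (hgd : AntitoneOn g (Ioi 0))
    (hfL : ∀ t : ℝ, 0 < t → (∫⁻ s in Ioc (0:ℝ) t, ENNReal.ofReal (Real.log (f s))) < ⊤)
    (hgL : ∀ t : ℝ, 0 < t → (∫⁻ s in Ioc (0:ℝ) t, ENNReal.ofReal (Real.log (g s))) < ⊤)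
    (h : ∀ t : ℝ, 0 < t → logIntF f t ≤ logIntF g t) {t r : ℝ} (hr : 0 < r) :
    (∫⁻ s in Ioc 0 t, ENNReal.ofReal (Real.log (r * f s))) ≤
      ∫⁻ s in Ioc 0 t, ENNReal.ofReal (Real.log (r * g s)) := by
  set S := {s ∈ Ioc 0 t | 1 < r * f s}
  have hzero : ∀ s ∈ Ioc 0 t, s ∉ S → ENNReal.ofReal (Real.log (r * f s)) = 0 := by
    intro s hs hsS
    refine ENNReal.ofReal_of_nonpos (Real.log_nonpos (mul_nonneg hr.le (hf0 s hs.1)) ?_)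
    by_contra! hlt
    exact hsS ⟨hs, hlt⟩
  rcases S.eq_empty_or_nonempty with hemp | hne
  · rw [setLIntegral_congr_fun measurableSet_Ioc
      (fun s hs => hzero s hs (by simp [hemp]))]
    simp
  have hbdd : BddAbove S := ⟨t, fun s hs => hs.1.2⟩
  obtain ⟨s₀, hs₀⟩ := hne
  set T := sSup S
  have hT0 : 0 < T := hs₀.1.1.trans_le (le_csSup hbdd hs₀)
  have hTt : T ≤ t := csSup_le ⟨s₀, hs₀⟩ fun s hs => hs.1.2
  have h1 : ∀ s ∈ Ioo 0 T, 1 ≤ r * f s := by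
    intro s hs
    obtain ⟨u, hu, hsu⟩ := exists_lt_of_lt_csSup ⟨s₀, hs₀⟩ hs.2
    exact hu.2.le.trans (mul_le_mul_of_nonneg_left (hfd hs.1 hu.1.1 hsu.le) hr.le)
  have hleft : (∫⁻ s in Ioc 0 t, ENNReal.ofReal (Real.log (r * f s))) ≤
      ∫⁻ s in Ioc 0 T, ENNReal.ofReal (Real.log (r * f s)) := by
    rw [← Ioc_union_Ioc_eq_Ioc hT0.le hTt]
    refine (lintegral_union_le _ _ _).trans_eq ?_
    rw [setLIntegral_congr_fun (s := Ioc T t) measurableSet_Ioc (fun s hs =>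
      hzero s ⟨hT0.trans hs.1, hs.2⟩ fun hsS => (le_csSup hbdd hsS).not_gt hs.1)]
    simp
  have hright : (∫⁻ s in Ioc 0 T, ENNReal.ofReal (Real.log (r * g s))) ≤
      ∫⁻ s in Ioc 0 t, ENNReal.ofReal (Real.log (r * g s)) :=
    lintegral_mono_set (Ioc_subset_Ioc_right hTt)
  refine hleft.trans (le_trans ?_ hright)
  have hi := (EReal.coe_sub_le_coe_sub_iff (hfL T hT0).ne (hgL T hT0).ne).1 (h T hT0)
  have ef := lintegral_log_mul_add hf0 hfd hr h1
  have eg := lintegral_log_add_le hg0 hgd hr T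
  have hl := setLIntegral_const_ne_top T (Real.log r)
  have hl' := setLIntegral_const_ne_top T (-Real.log r)
  have hA := (hfL T hT0).ne
  have hA' := (hgL T hT0).ne
  generalize (∫⁻ s in Ioc 0 T, ENNReal.ofReal (Real.log (f s))) = Af at *
  generalize (∫⁻ s in Ioc 0 T, ENNReal.ofReal (Real.log (g s))) = Ag at *
  generalize (∫⁻ s in Ioc 0 T, ENNReal.ofReal (Real.log (r * f s))) = If at *
  generalize (∫⁻ s in Ioc 0 T, ENNReal.ofReal (Real.log (r * g s))) = Ig at *
  generalize (∫⁻ s in Ioc 0 T, if f s = 0 then ⊤ else ENNReal.ofReal (-Real.log (f s))) = Bf at *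
  generalize (∫⁻ s in Ioc 0 T, if g s = 0 then ⊤ else ENNReal.ofReal (-Real.log (g s))) = Bg at *
  generalize (∫⁻ _ in Ioc 0 T, ENNReal.ofReal (Real.log r)) = l at *
  generalize (∫⁻ _ in Ioc 0 T, ENNReal.ofReal (-Real.log r)) = l' at *
  have hBf : Bf ≠ ⊤ := by
    rintro rfl
    exact ENNReal.add_ne_top.2 ⟨hA, hl⟩ (by simpa using ef.symm)
  have hBg : Bg ≠ ⊤ := by
    rintro rfl
    exact ENNReal.add_ne_top.2 ⟨hA', hBf⟩ (by simpa using hi)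
  have hfin : Bf + l' + Bg ≠ ⊤ := by simp [hBf, hl', hBg]
  refine (ENNReal.add_le_add_iff_right hfin).1 ?_
  calc If + (Bf + l' + Bg) = (If + Bf + l') + Bg := by ring
    _ = (Af + Bg) + l := by rw [ef]; ring
    _ ≤ (Ag + Bf) + l := by gcongr
    _ = (Ag + l) + Bf := by ring
    _ ≤ (Ig + Bg + l') + Bf := by gcongr
    _ = Ig + (Bf + l' + Bg) := by ring

lemma lintegral_Ioi_log_mul_eq (hg0 : ∀ s : ℝ, 0 < s → 0 ≤ g s) (hgd : AntitoneOn g (Ioi 0))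
    {t r : ℝ} (ht : 0 < t) (hr : 0 < r) (h1 : r * g t ≤ 1) :
    (∫⁻ s in Ioi 0, ENNReal.ofReal (Real.log (r * g s))) =
      ∫⁻ s in Ioc 0 t, ENNReal.ofReal (Real.log (r * g s)) := by
  rw [← Ioc_union_Ioi_eq_Ioi ht.le, lintegral_union measurableSet_Ioi
    (Ioc_disjoint_Ioi le_rfl), setLIntegral_congr_fun (s := Ioi t) measurableSet_Ioi (g := 0)]
  · simp
  · intro s (hs : t < s)
    have hs0 := ht.trans hs
    exact ENNReal.ofReal_of_nonpos (Real.log_nonpos (mul_nonneg hr.le (hg0 s hs0))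
      ((mul_le_mul_of_nonneg_left (hgd ht hs0 hs.le) hr.le).trans h1))

lemma logIntF_le_of_lintegral_log_mul_le (hf0 : ∀ s : ℝ, 0 < s → 0 ≤ f s)
    (hg0 : ∀ s : ℝ, 0 < s → 0 ≤ g s)
    (hfd : AntitoneOn f (Ioi 0)) (hgd : AntitoneOn g (Ioi 0))
    (hfL : ∀ t : ℝ, 0 < t → (∫⁻ s in Ioc (0:ℝ) t, ENNReal.ofReal (Real.log (f s))) < ⊤)
    (hgL : ∀ t : ℝ, 0 < t → (∫⁻ s in Ioc (0:ℝ) t, ENNReal.ofReal (Real.log (g s))) < ⊤)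
    (h : ∀ r : ℝ, 0 < r → (∫⁻ s in Ioi (0:ℝ), ENNReal.ofReal (Real.log (r * f s))) ≤
      ∫⁻ s in Ioi (0:ℝ), ENNReal.ofReal (Real.log (r * g s))) {t : ℝ} (ht : 0 < t) :
    logIntF f t ≤ logIntF g t := by
  refine (EReal.coe_sub_le_coe_sub_iff (hfL t ht).ne (hgL t ht).ne).2 ?_
  have hle : ∀ r : ℝ, 0 < r → r * g t ≤ 1 →
      (∫⁻ s in Ioc 0 t, ENNReal.ofReal (Real.log (r * f s))) ≤
        ∫⁻ s in Ioc 0 t, ENNReal.ofReal (Real.log (r * g s)) := fun r hr h1 =>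
    (lintegral_mono_set Ioc_subset_Ioi_self).trans
      ((h r hr).trans_eq (lintegral_Ioi_log_mul_eq hg0 hgd ht hr h1))
  rcases (hg0 t ht).eq_or_lt with hgt | hgt
  · have hstep : ∀ n : ℕ, (∫⁻ s in Ioc 0 t, ENNReal.ofReal (Real.log (f s))) +
        (∫⁻ s in Ioc 0 t, min (if g s = 0 then ⊤ else ENNReal.ofReal (-Real.log (g s)))
          (n : ℝ≥0∞)) ≤
        (∫⁻ s in Ioc 0 t, ENNReal.ofReal (Real.log (g s))) +
          ∫⁻ s in Ioc 0 t, if f s = 0 then ⊤ else ENNReal.ofReal (-Real.log (f s)) := by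
      intro n
      have hr : 1 ≤ Real.exp n := Real.one_le_exp n.cast_nonneg
      have ef := lintegral_log_add_le hf0 hfd (Real.exp_pos n) t
      have eg := lintegral_log_mul_add_min hg0 hgd hr t
      have hI := hle _ (Real.exp_pos n) (by simp [← hgt])
      have hl := setLIntegral_const_ne_top t (Real.log (Real.exp n))
      have hl0 : (∫⁻ _ in Ioc 0 t, ENNReal.ofReal (-Real.log (Real.exp n))) = 0 := by simp
      rw [hl0, add_zero] at ef
      rw [show (n : ℝ≥0∞) = ENNReal.ofReal (Real.log (Real.exp n)) by simp]
      refine (ENNReal.add_le_add_iff_right hl).1 ?_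
      rw [add_right_comm _ _ (∫⁻ _ in Ioc 0 t, ENNReal.ofReal (Real.log (Real.exp n))), add_right_comm
        (∫⁻ s in Ioc 0 t, ENNReal.ofReal (Real.log (g s))), ← eg]
      refine (add_le_add_left (ef.trans (add_le_add_left hI _)) _).trans_eq ?_
      ring
    have hN := hgd.aemeasurable_negPart_log t
    have hsup : (∫⁻ s in Ioc 0 t, if g s = 0 then ⊤ else ENNReal.ofReal (-Real.log (g s))) =
        ⨆ n : ℕ, ∫⁻ s in Ioc 0 t,
          min (if g s = 0 then ⊤ else ENNReal.ofReal (-Real.log (g s))) (n : ℝ≥0∞) := by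
      rw [← lintegral_iSup' (fun n => hN.min aemeasurable_const)
        (ae_of_all _ fun s m n hmn => min_le_min_left _ (Nat.cast_le.2 hmn))]
      refine lintegral_congr fun s => ?_
      rw [← inf_iSup_eq, ENNReal.iSup_natCast, inf_top_eq]
    rw [hsup, ENNReal.add_iSup]
    exact iSup_le hstep
  · have hr : 0 < (g t)⁻¹ := inv_pos.2 hgt
    have ef := lintegral_log_add_le hf0 hfd hr t
    have eg := lintegral_log_mul_add hg0 hgd hr (t := t) fun s hs => by
      rw [le_inv_mul_iff₀ hgt, mul_one]
      exact hgd hs.1 ht hs.2.le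
    have hI := hle _ hr (inv_mul_cancel₀ hgt.ne').le
    have hl := setLIntegral_const_ne_top t (Real.log (g t)⁻¹)
    refine (ENNReal.add_le_add_iff_right hl).1 ?_
    rw [add_right_comm, add_right_comm _ _ (∫⁻ _ in Ioc 0 t, ENNReal.ofReal (Real.log (g t)⁻¹)),
      ← eg]
    refine (add_le_add_left ef _).trans ?_
    refine (add_le_add_left (add_le_add_left (add_le_add_left hI _) _) _).trans_eq ?_
    ring

end Antitone

end LogMajorization

/-- L.G. Brown: for non-increasing `f, g : (0,∞) → [0,∞)` with
`∫₀ᵗ log₊ f < ∞` and `∫₀ᵗ log₊ g < ∞` for all `t > 0`, the following are equivalent: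
(i) `∫₀ᵗ log f ≤ ∫₀ᵗ log g` for all `t > 0`;
(ii) `∫₀^∞ log₊(r f) ≤ ∫₀^∞ log₊(r g)` for all `r > 0`;
(iii) `∫₀ᵗ φ(f) ≤ ∫₀ᵗ φ(g)` for all `t > 0` and all continuous increasing
`φ : [0,∞) → [0,∞)` with `φ(0) = 0` such that `φ ∘ exp` is convex. -/
theorem brown_log_majorization_equivalences (f g : ℝ → ℝ)
    (hf0 : ∀ s : ℝ, 0 < s → 0 ≤ f s) (hg0 : ∀ s : ℝ, 0 < s → 0 ≤ g s)
    (hfd : AntitoneOn f (Set.Ioi 0)) (hgd : AntitoneOn g (Set.Ioi 0))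
    (hfL : ∀ t : ℝ, 0 < t →
      (∫⁻ s in Set.Ioc (0:ℝ) t, ENNReal.ofReal (Real.log (f s))) < ⊤)
    (hgL : ∀ t : ℝ, 0 < t →
      (∫⁻ s in Set.Ioc (0:ℝ) t, ENNReal.ofReal (Real.log (g s))) < ⊤) :
    List.TFAE
      [ ∀ t : ℝ, 0 < t → logIntF f t ≤ logIntF g t,
        ∀ r : ℝ, 0 < r →
          (∫⁻ s in Set.Ioi (0:ℝ), ENNReal.ofReal (Real.log (r * f s))) ≤
            ∫⁻ s in Set.Ioi (0:ℝ), ENNReal.ofReal (Real.log (r * g s)),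
        ∀ φ : ℝ → ℝ, Continuous φ → MonotoneOn φ (Set.Ici 0) → φ 0 = 0 →
          ConvexOn ℝ Set.univ (fun u => φ (Real.exp u)) →
          ∀ t : ℝ, 0 < t →
            (∫⁻ s in Set.Ioc (0:ℝ) t, ENNReal.ofReal (φ (f s))) ≤
              ∫⁻ s in Set.Ioc (0:ℝ) t, ENNReal.ofReal (φ (g s)) ] := by
  tfae_have 1 → 3 := by
    intro h φ hφ hmono hφ0 hconv t _
    refine lintegral_comp_le_of_convexOn_comp_exp ?_ (hfd.aemeasurable_Ioc t) ?_
      (hgd.aemeasurable_Ioc t) (fun r hr => ?_) hφ.continuousOn hmono hφ0 hconv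
    · exact (ae_restrict_mem measurableSet_Ioc).mono fun s hs => hf0 s hs.1
    · exact (ae_restrict_mem measurableSet_Ioc).mono fun s hs => hg0 s hs.1
    · exact lintegral_log_mul_le_of_logIntF_le hf0 hg0 hfd hgd hfL hgL h hr
  tfae_have 3 → 2 := by
    intro h r hr
    rw [lintegral_Ioi_eq_iSup_lintegral_Ioc, lintegral_Ioi_eq_iSup_lintegral_Ioc]
    refine iSup_mono fun n => ?_
    have hn := h (fun x => Real.log (max 1 (r * x)))
      (Continuous.log (by fun_prop) fun x => (zero_lt_one.trans_le (le_max_left _ _)).ne')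
      (fun x _ y _ hxy => Real.log_le_log (zero_lt_one.trans_le (le_max_left _ _))
        (max_le_max_left _ (mul_le_mul_of_nonneg_left hxy hr.le)))
      (by simp) (convexOn_log_max_one_mul_exp hr) (n + 1) (by positivity)
    rwa [setLIntegral_congr_fun measurableSet_Ioc
        (fun s hs => ofReal_log_max_one (r * f s) (mul_nonneg hr.le (hf0 s hs.1))),
      setLIntegral_congr_fun measurableSet_Ioc
        (fun s hs => ofReal_log_max_one (r * g s) (mul_nonneg hr.le (hg0 s hs.1)))] at hn
  tfae_have 2 → 1 := fun h t ht =>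
    logIntF_le_of_lintegral_log_mul_le hf0 hg0 hfd hgd hfL hgL h ht
  tfae_finish
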